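/- arXiv:2206.05779 — 4 statements merged into one kernel-verified Lean document; each statement's English description precedes it below -/
import Mathlib

section
/- Let K be a subfield of the real numbers that is a finite extension of ℚ of degree D (i.e., the dimension of K as a ℚ-vector space is D). If A is an element of SL(2,ℝ) all of whose matrix entries lie in K and A has finite order n, then n ≤ 32·D². -/
open Polynomial in
/-- Over an algebraically closed field, a `2 × 2` matrix of determinant one and finite order prime
to the characteristic has an eigenvalue that is a primitive root of unity of that order. -/
theorem Matrix.exists_isPrimitiveRoot_charpoly_isRoot {F : Type*} [Field F] [IsAlgClosed F]
    (M : Matrix (Fin 2) (Fin 2) F) (hdet : M.det = 1) (hn : (orderOf M : F) ≠ 0) :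
    ∃ z : F, IsPrimitiveRoot z (orderOf M) ∧ M.charpoly.IsRoot z := by
  have hdvd : minpoly F M ∣ X ^ orderOf M - 1 :=
    minpoly.dvd F M (by simp [pow_orderOf_eq_one])
  obtain ⟨z, hz⟩ := IsAlgClosed.exists_root (minpoly F M)
    (minpoly.degree_pos (Algebra.IsIntegral.isIntegral M)).ne'
  have hroot : ∀ w, (minpoly F M).IsRoot w → w ^ 2 - M.trace * w + 1 = 0 := fun w hw ↦ by
    simpa [Matrix.charpoly_fin_two, hdet] using hw.dvd M.minpoly_dvd_charpoly
  refine ⟨z, ⟨by simpa [sub_eq_zero] using hz.dvd hdvd, fun k hk ↦ orderOf_dvd_of_pow_eq_one ?_⟩,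
    hz.dvd M.minpoly_dvd_charpoly⟩
  obtain rfl | hk0 := k.eq_zero_or_pos
  · simp
  have hz2 := hroot z hz
  have hdvd' : minpoly F M ∣ X ^ k - 1 := by
    refine (IsAlgClosed.splits _).dvd_of_roots_le_roots
      (minpoly.ne_zero (Algebra.IsIntegral.isIntegral M)) ?_
    rw [Multiset.le_iff_subset (nodup_roots ((X_pow_sub_one_separable_iff.mpr hn).of_dvd hdvd))]
    intro w hw
    rw [mem_roots', IsRoot.def] at hw
    have hw2 := hroot w hw.2
    suffices w ^ k = 1 from (mem_roots (X_pow_sub_C_ne_zero hk0 1)).mpr (by simp [this])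
    have hprod : (w - z) * (z * w - 1) = 0 := by linear_combination z * hw2 - w * hz2
    obtain h | h := mul_eq_zero.mp hprod
    · rwa [sub_eq_zero.mp h]
    · rw [← one_mul (w ^ k), ← hk, ← mul_pow, sub_eq_zero.mp h, one_pow, hk]
  simpa [sub_eq_zero] using aeval_eq_zero_of_dvd_aeval_eq_zero hdvd' (minpoly.aeval F M)

theorem Matrix.orderOf_map {m R S : Type*} [Fintype m] [DecidableEq m] [Semiring R] [Semiring S]
    (f : R →+* S) (hf : Function.Injective f) (M : Matrix m m R) :
    orderOf (M.map f) = orderOf M :=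
  orderOf_injective (f.mapMatrix : Matrix m m R →+* Matrix m m S).toMonoidHom
    (Matrix.map_injective hf) M

open IntermediateField in
theorem minpoly.natDegree_le_finrank_mul {F L : Type*} (E : Type*) [Field F] [Field E] [Field L]
    [Algebra F E] [Algebra E L] [Algebra F L] [IsScalarTower F E L] [FiniteDimensional F E]
    {z : L} (hz : IsIntegral E z) :
    (minpoly F z).natDegree ≤ Module.finrank F E * (minpoly E z).natDegree := by
  have : FiniteDimensional E E⟮z⟯ := adjoin.finiteDimensional hz
  have : FiniteDimensional F E⟮z⟯ := .trans F E E⟮z⟯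
  have : IsScalarTower F E⟮z⟯ L := .to₁₃₄ F E E⟮z⟯ L
  rw [← adjoin.finrank hz, Module.finrank_mul_finrank,
    ← AdjoinSimple.algebraMap_gen E z,
    minpoly.algebraMap_eq (algebraMap E⟮z⟯ L).injective]
  exact minpoly.natDegree_le _

theorem Nat.le_totient_sq_of_odd {n : ℕ} (hn : Odd n) : n ≤ n.totient ^ 2 := by
  induction n using Nat.recOnPosPrimePosCoprime with
  | prime_pow p k hp hk =>
    have hp2 : p ≠ 2 := by
      rintro rfl
      exact absurd hn (by simp [Nat.odd_pow_iff hk.ne'])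
    obtain ⟨q, rfl⟩ : ∃ q, p = q + 3 := ⟨p - 3, by have := hp.two_le; omega⟩
    obtain ⟨j, rfl⟩ : ∃ j, k = j + 1 := ⟨k - 1, by omega⟩
    rw [Nat.totient_prime_pow_succ hp, mul_pow, pow_succ]
    exact Nat.mul_le_mul (Nat.le_self_pow two_ne_zero _)
      (by rw [show q + 3 - 1 = q + 2 by omega]; nlinarith)
  | zero => simp
  | one => simp
  | coprime a b _ _ hab iha ihb =>
    obtain ⟨ha, hb⟩ := Nat.odd_mul.mp hn
    rw [Nat.totient_mul hab, mul_pow]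
    exact Nat.mul_le_mul (iha ha) (ihb hb)

theorem Nat.le_two_mul_totient_sq (n : ℕ) : n ≤ 2 * n.totient ^ 2 := by
  obtain rfl | hn := eq_or_ne n 0
  · simp
  obtain ⟨a, m, hm, rfl⟩ := Nat.exists_eq_two_pow_mul_odd hn
  rw [Nat.totient_mul (hm.coprime_two_left.pow_left a), mul_pow, ← mul_assoc]
  refine Nat.mul_le_mul ?_ (Nat.le_totient_sq_of_odd hm)
  obtain _ | a := a
  · simp
  · rw [Nat.totient_prime_pow_succ Nat.prime_two, pow_succ, mul_comm]
    simpa using Nat.le_self_pow two_ne_zero (2 ^ a)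

/-- If `A ∈ SL(2,ℝ)` has all entries in a subfield `K ≤ ℝ` that is a finite
extension of `ℚ` of degree `D`, and `A` has finite order `n`, then `n ≤ 32 D²`. -/
theorem elliptic_order_bound
    (K : IntermediateField ℚ ℝ) [FiniteDimensional ℚ K] (D : ℕ)
    (hD : Module.finrank ℚ K = D)
    (A : Matrix.SpecialLinearGroup (Fin 2) ℝ)
    (hA : ∀ i j, (A : Matrix (Fin 2) (Fin 2) ℝ) i j ∈ K)
    (n : ℕ) (hn : 0 < n) (horder : orderOf A = n) :
    n ≤ 32 * D ^ 2 := by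
  obtain ⟨B, hB⟩ : ∃ B : Matrix (Fin 2) (Fin 2) K,
      B.map (algebraMap K ℝ) = (A : Matrix (Fin 2) (Fin 2) ℝ) :=
    ⟨.of fun i j ↦ ⟨_, hA i j⟩, rfl⟩
  have hBA : orderOf B = n := by
    rw [← horder, ← orderOf_injective Matrix.SpecialLinearGroup.coeMonoidHom
      Matrix.SpecialLinearGroup.coeMonoidHom_injective A,
      Matrix.SpecialLinearGroup.coeMonoidHom_apply, ← hB,
      Matrix.orderOf_map _ (algebraMap K ℝ).injective]
  have hBC : orderOf (B.map (algebraMap K ℂ)) = n := by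
    rw [Matrix.orderOf_map _ (algebraMap K ℂ).injective, hBA]
  have hdetB : B.det = 1 := by
    apply (algebraMap K ℝ).injective
    rw [RingHom.map_det, RingHom.mapMatrix_apply, hB, A.det_coe, map_one]
  obtain ⟨z, hz, hroot⟩ := Matrix.exists_isPrimitiveRoot_charpoly_isRoot
    (B.map (algebraMap K ℂ)) (by rw [← RingHom.mapMatrix_apply, ← RingHom.map_det, hdetB, map_one])
    (by rw [hBC]; exact_mod_cast hn.ne')
  rw [hBC] at hz
  have haeval : Polynomial.aeval z B.charpoly = 0 := by
    rwa [Matrix.charpoly_map, Polynomial.IsRoot.def, Polynomial.eval_map_algebraMap] at hroot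
  have hdeg : (minpoly K z).natDegree ≤ 2 := by
    simpa using Polynomial.natDegree_le_of_dvd (minpoly.dvd K z haeval) B.charpoly_monic.ne_zero
  have hz_int : IsIntegral K z := ⟨B.charpoly, B.charpoly_monic, haeval⟩
  have htot : n.totient ≤ D * 2 := by
    rw [← Polynomial.natDegree_cyclotomic n ℚ, Polynomial.cyclotomic_eq_minpoly_rat hz hn, ← hD]
    exact (minpoly.natDegree_le_finrank_mul K hz_int).trans (Nat.mul_le_mul_left _ hdeg)
  calc
    n ≤ 2 * n.totient ^ 2 := n.le_two_mul_totient_sq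
    _ ≤ 2 * (D * 2) ^ 2 := by gcongr
    _ ≤ 32 * D ^ 2 := by nlinarith [sq_nonneg D]
end

section
/- Let K be a subfield of the real numbers that is a finite extension of ℚ of degree D. If A is an element of SL(2,ℝ) all of whose matrix entries lie in K and A has finite order exactly n, then Euler's totient φ(n) satisfies φ(n) ≤ 2·D. -/
open Polynomial IntermediateField

/-- A square-zero perturbation of the identity which has finite order is the identity. -/
lemma eq_zero_of_one_add_pow_eq_one {R : Type*} [Ring R] [IsAddTorsionFree R] {N : R}
    (hN : N * N = 0) {n : ℕ} (hn : n ≠ 0) (h : (1 + N) ^ n = 1) : N = 0 := by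
  have key : ∀ k : ℕ, (1 + N) ^ k = 1 + k • N := by
    intro k
    induction k with
    | zero => simp
    | succ k ih =>
      rw [pow_succ, ih, add_mul, mul_add, smul_mul_assoc, mul_add, hN, succ_nsmul]
      simp only [mul_one, one_mul, add_zero]
      abel
  have hnN : n • N = 0 := by simpa [key n] using h
  exact (nsmul_eq_zero_iff_right hn).mp hnN

/-- A `2 × 2` matrix of determinant one and finite order with eigenvalue `1` is the identity. -/
lemma Matrix.eq_one_of_det_sub_one_eq_zero {F : Type*} [Field F] [CharZero F]
    {B : Matrix (Fin 2) (Fin 2) F} (hdet : B.det = 1) (h1 : (B - 1).det = 0)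
    {n : ℕ} (hn : n ≠ 0) (hB : B ^ n = 1) : B = 1 := by
  have htr : B 0 0 + B 1 1 = 2 := by
    simp only [Matrix.det_fin_two, Matrix.sub_apply, Matrix.one_apply] at hdet h1
    simp at h1
    linear_combination hdet - h1
  have hsq : (B - 1) * (B - 1) = 0 := by
    rw [Matrix.det_fin_two] at hdet
    ext i j
    fin_cases i <;> fin_cases j <;> simp [Matrix.mul_apply, Fin.sum_univ_two]
    · linear_combination B 0 0 * htr - hdet
    · linear_combination B 0 1 * htr
    · linear_combination B 1 0 * htr
    · linear_combination B 1 1 * htr - hdet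
  have : IsAddTorsionFree (Matrix (Fin 2) (Fin 2) F) :=
    inferInstanceAs (IsAddTorsionFree (Fin 2 → Fin 2 → F))
  exact sub_eq_zero.mp (eq_zero_of_one_add_pow_eq_one hsq hn (by simpa using hB))

/-- If `μ` is an eigenvalue of `C`, then `μ ^ k` is an eigenvalue of `C ^ k`. -/
lemma Matrix.det_pow_sub_smul_one_eq_zero {F ι : Type*} [Field F] [Fintype ι] [DecidableEq ι]
    {C : Matrix ι ι F} {μ : F} (h : (C - μ • 1).det = 0) (k : ℕ) :
    (C ^ k - μ ^ k • 1).det = 0 := by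
  have hc : Commute C (μ • (1 : Matrix ι ι F)) := (Commute.one_right C).smul_right μ
  have hdvd := map_dvd Matrix.detMonoidHom (hc.sub_dvd_pow_sub_pow k)
  rw [_root_.smul_pow, one_pow] at hdvd
  simpa [h] using hdvd

/-- An eigenvalue of a `2 × 2` matrix of determinant one and finite order `n` is a primitive
`n`-th root of unity. -/
lemma Matrix.isPrimitiveRoot_of_det_sub_smul_one_eq_zero {F : Type*} [Field F] [CharZero F]
    {C : Matrix (Fin 2) (Fin 2) F} (hdet : C.det = 1) {μ : F}
    (hμ : (C - μ • 1).det = 0) (hC : 0 < orderOf C) : IsPrimitiveRoot μ (orderOf C) := by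
  refine ⟨?_, fun m hm => ?_⟩
  · have h := Matrix.det_pow_sub_smul_one_eq_zero hμ (orderOf C)
    rw [pow_orderOf_eq_one, Matrix.det_fin_two] at h
    simp at h
    exact (sub_eq_zero.mp h).symm
  · have h := Matrix.det_pow_sub_smul_one_eq_zero hμ m
    rw [hm, one_smul] at h
    refine orderOf_dvd_of_pow_eq_one
      (Matrix.eq_one_of_det_sub_one_eq_zero (by rw [Matrix.det_pow, hdet, one_pow]) h hC.ne' ?_)
    rw [← pow_mul, mul_comm, pow_mul, pow_orderOf_eq_one, one_pow]

/-- If a primitive `n`-th root of unity is a root of a monic polynomial over a number field `K`,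
then `φ n` is at most `[K : ℚ]` times the degree of this polynomial. -/
lemma IsPrimitiveRoot.totient_le_finrank_mul_natDegree {K L : Type*} [Field K] [Field L]
    [CharZero K] [CharZero L] [Algebra K L] [FiniteDimensional ℚ K]
    {μ : L} {n : ℕ} (h : IsPrimitiveRoot μ n) (hn : 0 < n) {p : K[X]} (hp : p.Monic)
    (hroot : aeval μ p = 0) : n.totient ≤ Module.finrank ℚ K * p.natDegree := by
  have hint : IsIntegral K μ := ⟨p, hp, hroot⟩
  have : FiniteDimensional K K⟮μ⟯ := adjoin.finiteDimensional hint
  have : FiniteDimensional ℚ K⟮μ⟯ := FiniteDimensional.trans ℚ K K⟮μ⟯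
  calc n.totient = (minpoly ℚ μ).natDegree := by
        rw [← cyclotomic_eq_minpoly_rat h hn, natDegree_cyclotomic]
    _ = (minpoly ℚ (AdjoinSimple.gen K μ)).natDegree := by
        rw [← minpoly.algebraMap_eq (algebraMap K⟮μ⟯ L).injective, AdjoinSimple.algebraMap_gen]
    _ ≤ Module.finrank ℚ K⟮μ⟯ := minpoly.natDegree_le _
    _ = Module.finrank ℚ K * (minpoly K μ).natDegree := by
        rw [← Module.finrank_mul_finrank ℚ K K⟮μ⟯, adjoin.finrank hint]
    _ ≤ Module.finrank ℚ K * p.natDegree :=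
        Nat.mul_le_mul_left _ (natDegree_le_of_dvd (minpoly.dvd K μ hroot) hp.ne_zero)

/-- If `A ∈ SL(2,ℝ)` has all entries in a subfield `K ≤ ℝ` that is a finite
extension of `ℚ` of degree `D`, and `A` has finite order exactly `n`, then
Euler's totient satisfies `φ(n) ≤ 2 D`. -/
theorem totient_of_order_le
    (K : IntermediateField ℚ ℝ) [FiniteDimensional ℚ K] (D : ℕ)
    (hD : Module.finrank ℚ K = D)
    (A : Matrix.SpecialLinearGroup (Fin 2) ℝ)
    (hA : ∀ i j, (A : Matrix (Fin 2) (Fin 2) ℝ) i j ∈ K)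
    (n : ℕ) (hn : 0 < n) (horder : orderOf A = n) :
    Nat.totient n ≤ 2 * D := by
  let M : Matrix (Fin 2) (Fin 2) K := fun i j => ⟨A i j, hA i j⟩
  let f : K →+* ℂ := algebraMap K ℂ
  have hMA : (algebraMap K ℝ).mapMatrix M = A := rfl
  have hinj : ∀ {R S : Type} [Field R] [Field S] (g : R →+* S),
      Function.Injective (g.mapMatrix (m := Fin 2)) := fun g => Matrix.map_injective g.injective
  have hordM : orderOf M = n := by
    rw [← orderOf_injective ((algebraMap K ℝ).mapMatrix (m := Fin 2)).toMonoidHom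
      (hinj _) M, ← horder]
    exact orderOf_injective Matrix.SpecialLinearGroup.coeMonoidHom
      Matrix.SpecialLinearGroup.coeMonoidHom_injective A
  have hdetM : M.det = 1 := by
    apply (algebraMap K ℝ).injective
    rw [RingHom.map_det, hMA, A.det_coe, map_one]
  have hordC : orderOf (f.mapMatrix M) = n := by
    rw [← hordM]
    exact orderOf_injective (f.mapMatrix (m := Fin 2)).toMonoidHom (hinj _) M
  have hdetC : (f.mapMatrix M).det = 1 := by rw [← RingHom.map_det, hdetM, map_one]
  obtain ⟨μ, hμ⟩ := IsAlgClosed.exists_aeval_eq_zero ℂ M.charpoly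
    (by rw [Matrix.charpoly_degree_eq_dim]; simp)
  have hprim : IsPrimitiveRoot μ n := by
    rw [← hordC]
    refine Matrix.isPrimitiveRoot_of_det_sub_smul_one_eq_zero hdetC ?_ (hordC ▸ hn)
    rw [aeval_def, eval₂_eq_eval_map, ← Matrix.charpoly_map, Matrix.eval_charpoly] at hμ
    rw [← neg_sub, Matrix.det_neg, Matrix.smul_one_eq_diagonal]
    exact mul_eq_zero_of_right _ hμ
  have := hprim.totient_le_finrank_mul_natDegree hn M.charpoly_monic hμ
  rwa [Matrix.charpoly_natDegree_eq_dim, Fintype.card_fin, hD, mul_comm] at this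
end

section
/- Let A, B ∈ SL(2,ℝ) satisfy tr(A) ≥ tr(B) > 2 and tr(A·B⁻¹) ≤ −2. Then the subgroup G = ⟨A, B⟩ of SL(2,ℝ) generated by A and B is discrete (its subspace topology is discrete) and is free of rank 2 on the generators A and B; that is, the group homomorphism from the free group on two generators to SL(2,ℝ) sending the two generators to A and B respectively is injective. -/
/-- The subspace topology on `SL(n, R)`, inherited from the space of matrices. -/
instance SLtop (n : Type*) [DecidableEq n] [Fintype n]
    (R : Type*) [CommRing R] [TopologicalSpace R] :
    TopologicalSpace (Matrix.SpecialLinearGroup n R) :=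
  TopologicalSpace.induced (fun A => (A : Matrix n n R)) inferInstance

open Matrix

/-- The area form `ω(v, P v)`. For a reflection `P` its sign tells the two arcs of the projective
line cut out by the fixed points of `P` apart. -/
def areaForm (P : Matrix (Fin 2) (Fin 2) ℝ) (v : Fin 2 → ℝ) : ℝ :=
  v 0 * (P *ᵥ v) 1 - v 1 * (P *ᵥ v) 0

lemma areaForm_eq (P : Matrix (Fin 2) (Fin 2) ℝ) (v : Fin 2 → ℝ) :
    areaForm P v = P 1 0 * v 0 ^ 2 + (P 1 1 - P 0 0) * v 0 * v 1 - P 0 1 * v 1 ^ 2 := by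
  simp only [areaForm, mulVec, dotProduct, Fin.sum_univ_two]
  ring

lemma areaForm_add (P Q : Matrix (Fin 2) (Fin 2) ℝ) (v : Fin 2 → ℝ) :
    areaForm (P + Q) v = areaForm P v + areaForm Q v := by
  simp only [areaForm_eq, Matrix.add_apply]
  ring

lemma areaForm_neg (P : Matrix (Fin 2) (Fin 2) ℝ) (v : Fin 2 → ℝ) :
    areaForm (-P) v = -areaForm P v := by
  simp only [areaForm_eq, Matrix.neg_apply]
  ring

lemma areaForm_neg_right (P : Matrix (Fin 2) (Fin 2) ℝ) (v : Fin 2 → ℝ) :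
    areaForm P (-v) = areaForm P v := by
  simp only [areaForm_eq, Pi.neg_apply]
  ring

/-- A reflection exchanges the two arcs it cuts out. -/
lemma areaForm_mulVec_self {P : Matrix (Fin 2) (Fin 2) ℝ} (hP : P * P = 1) (v : Fin 2 → ℝ) :
    areaForm P (P *ᵥ v) = -areaForm P v := by
  simp only [areaForm, mulVec_mulVec, hP, one_mulVec]
  ring

lemma trace_fin_two_eq_zero {P : Matrix (Fin 2) (Fin 2) ℝ} (hP : P.trace = 0) :
    P 1 1 = -P 0 0 := by
  rw [trace_fin_two] at hP
  linarith

lemma mul_self_eq_one_of_trace_det {P : Matrix (Fin 2) (Fin 2) ℝ} (ht : P.trace = 0)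
    (hd : P.det = -1) : P * P = 1 := by
  have h := trace_fin_two_eq_zero ht
  rw [det_fin_two, h] at hd
  ext i j
  fin_cases i <;> fin_cases j <;> simp [mul_apply, Fin.sum_univ_two, h] <;> linarith

lemma areaForm_nonpos_iff {M : Matrix (Fin 2) (Fin 2) ℝ} (ht : M.trace = 0) (hd : 0 ≤ M.det) :
    (∀ v, areaForm M v ≤ 0) ↔ M 1 0 ≤ 0 ∧ 0 ≤ M 0 1 := by
  have h := trace_fin_two_eq_zero ht
  rw [det_fin_two, h] at hd
  constructor
  · intro H
    have h0 := H ![1, 0]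
    have h1 := H ![0, 1]
    simp [areaForm_eq] at h0 h1
    exact ⟨h0, h1⟩
  · rintro ⟨hc, hb⟩ v
    rw [areaForm_eq, h]
    have key : (M 0 0 * (v 0 * v 1)) ^ 2 ≤ (-M 1 0 * v 0 ^ 2) * (M 0 1 * v 1 ^ 2) := by
      have := mul_le_mul_of_nonneg_right (show M 0 0 ^ 2 ≤ -M 1 0 * M 0 1 by nlinarith)
        (sq_nonneg (v 0 * v 1))
      nlinarith
    have h1 : 0 ≤ -M 1 0 * v 0 ^ 2 := mul_nonneg (by linarith) (sq_nonneg _)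
    have h2 : 0 ≤ M 0 1 * v 1 ^ 2 := mul_nonneg hb (sq_nonneg _)
    have : |2 * (M 0 0 * (v 0 * v 1))| ≤ -M 1 0 * v 0 ^ 2 + M 0 1 * v 1 ^ 2 :=
      abs_le_of_sq_le_sq (by nlinarith [sq_nonneg (-M 1 0 * v 0 ^ 2 - M 0 1 * v 1 ^ 2)])
        (by linarith)
    linarith [(abs_le.mp this).1]

lemma areaForm_neg_of_det_pos {M : Matrix (Fin 2) (Fin 2) ℝ} (ht : M.trace = 0) (hd : 0 < M.det)
    (hM : ∀ v, areaForm M v ≤ 0) {v : Fin 2 → ℝ} (hv : v ≠ 0) : areaForm M v < 0 := by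
  obtain ⟨hc, hb⟩ := (areaForm_nonpos_iff ht hd.le).1 hM
  have h := trace_fin_two_eq_zero ht
  rw [det_fin_two, h] at hd
  refine lt_of_le_of_ne (hM v) fun h0 => hv ?_
  rw [areaForm_eq, h] at h0
  have hc' : M 1 0 ≠ 0 := fun h' => by rw [h'] at hd; nlinarith [sq_nonneg (M 0 0)]
  have e : (M 1 0 * v 0 - M 0 0 * v 1) ^ 2 + (M 0 0 * -M 0 0 - M 0 1 * M 1 0) * v 1 ^ 2 = 0 := by
    linear_combination M 1 0 * h0
  have v1 : v 1 = 0 := by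
    have : v 1 ^ 2 = 0 := by nlinarith [sq_nonneg (M 1 0 * v 0 - M 0 0 * v 1), sq_nonneg (v 1)]
    simpa using this
  have v0 : v 0 = 0 := by simpa [v1, hc'] using e
  ext i
  fin_cases i <;> simp [v0, v1]

lemma areaForm_nonpos_or_neg {M : Matrix (Fin 2) (Fin 2) ℝ} (ht : M.trace = 0)
    (hd : 0 ≤ M.det) : (∀ v, areaForm M v ≤ 0) ∨ ∀ v, areaForm (-M) v ≤ 0 := by
  have h := trace_fin_two_eq_zero ht
  rw [areaForm_nonpos_iff ht hd,
    areaForm_nonpos_iff (by simp [ht]) (by simpa [det_neg] using hd)]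
  rw [det_fin_two, h] at hd
  simp only [Matrix.neg_apply]
  rcases le_total (M 1 0) 0 with hc | hc <;> rcases le_total 0 (M 0 1) with hb | hb
  · exact Or.inl ⟨hc, hb⟩
  · rcases hc.lt_or_eq with hc | hc
    · exact Or.inl ⟨hc.le, by nlinarith [sq_nonneg (M 0 0)]⟩
    · exact Or.inr ⟨by linarith, by linarith⟩
  · rcases hc.lt_or_eq with hc | hc
    · exact Or.inr ⟨by linarith, by nlinarith [sq_nonneg (M 0 0)]⟩
    · exact Or.inl ⟨hc.ge, hb⟩
  · exact Or.inr ⟨by linarith, by linarith⟩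

/-- Semidefinite forms with negative pairing have the same sign: causal vectors of Minkowski space
with negative inner product lie in the same cone. -/
lemma areaForm_nonpos_of_trace_mul_neg {M K : Matrix (Fin 2) (Fin 2) ℝ} (hMt : M.trace = 0)
    (hMd : 0 ≤ M.det) (hKt : K.trace = 0) (hKd : 0 ≤ K.det) (hMK : (M * K).trace < 0)
    (hM : ∀ v, areaForm M v ≤ 0) : ∀ v, areaForm K v ≤ 0 := by
  refine (areaForm_nonpos_or_neg hKt hKd).resolve_right fun hK => ?_
  obtain ⟨hc, hb⟩ := (areaForm_nonpos_iff hMt hMd).1 hM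
  obtain ⟨hc', hb'⟩ := (areaForm_nonpos_iff (by simp [hKt]) (by simpa [det_neg] using hKd)).1 hK
  have h := trace_fin_two_eq_zero hMt
  have h' := trace_fin_two_eq_zero hKt
  simp only [Matrix.neg_apply] at hc' hb'
  rw [det_fin_two, h] at hMd
  rw [det_fin_two, h'] at hKd
  simp only [trace_fin_two, mul_apply, Fin.sum_univ_two, h, h'] at hMK
  have key : (M 0 0 * K 0 0) ^ 2 ≤ (M 0 1 * K 1 0) * (M 1 0 * K 0 1) := by
    have := mul_le_mul (show M 0 0 ^ 2 ≤ -M 1 0 * M 0 1 by nlinarith)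
      (show K 0 0 ^ 2 ≤ -K 1 0 * K 0 1 by nlinarith) (sq_nonneg _) (by nlinarith)
    nlinarith
  have h1 : 0 ≤ M 0 1 * K 1 0 := mul_nonneg hb (by linarith)
  have h2 : 0 ≤ M 1 0 * K 0 1 := mul_nonneg_of_nonpos_of_nonpos hc (by linarith)
  have : |2 * (M 0 0 * K 0 0)| ≤ M 0 1 * K 1 0 + M 1 0 * K 0 1 :=
    abs_le_of_sq_le_sq (by nlinarith [sq_nonneg (M 0 1 * K 1 0 - M 1 0 * K 0 1)]) (by linarith)
  linarith [(abs_le.mp this).1]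

lemma exists_areaForm_pos {P : Matrix (Fin 2) (Fin 2) ℝ} (ht : P.trace = 0) (hP : P * P = 1) :
    ∃ v, 0 < areaForm P v := by
  by_contra! H
  have H' : ∀ v, areaForm P v = 0 := fun v =>
    le_antisymm (H v) (by linarith [H (P *ᵥ v), areaForm_mulVec_self hP v])
  have h := trace_fin_two_eq_zero ht
  have h0 := H' ![1, 0]
  have h1 := H' ![0, 1]
  have h2 := H' ![1, 1]
  have e := congrFun₂ hP 0 0
  simp [areaForm_eq] at h0 h1 h2
  simp [mul_apply, Fin.sum_univ_two, h0, h1] at e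
  rw [h0, h1, h] at h2
  nlinarith

/-- Three reflections bounding disjoint arcs, the first two having disjoint closures, leave a gap
on the projective line. -/
lemma exists_areaForm_neg {P Q R : Matrix (Fin 2) (Fin 2) ℝ} (hPt : P.trace = 0)
    (hQt : Q.trace = 0) (hP : P * P = 1) (hQ : Q * Q = 1) (hPQ : 0 < (P + Q).det)
    (hPQn : ∀ v, areaForm (P + Q) v ≤ 0) (hPR : ∀ v, areaForm (P + R) v ≤ 0)
    (hQR : ∀ v, areaForm (Q + R) v ≤ 0) :
    ∃ v, areaForm P v < 0 ∧ areaForm Q v < 0 ∧ areaForm R v < 0 := by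
  obtain ⟨w, hw⟩ := exists_areaForm_pos hPt hP
  have hp := trace_fin_two_eq_zero hPt
  have hq := trace_fin_two_eq_zero hQt
  have eP := congrFun₂ hP 0 0
  have eQ := congrFun₂ hQ 0 0
  simp [mul_apply, Fin.sum_univ_two] at eP eQ
  set M := P - Q with hM
  have hMt : M.trace = 0 := by simp [hM, hPt, hQt]
  have hm := trace_fin_two_eq_zero hMt
  obtain ⟨μ, hμ, hμM⟩ : ∃ μ : ℝ, 0 < μ ∧ μ ^ 2 = -M.det := by
    have : 0 < -M.det := by
      simp only [hM, det_fin_two, Matrix.add_apply, Matrix.sub_apply, hp, hq] at hPQ ⊢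
      nlinarith
    exact ⟨√(-M.det), Real.sqrt_pos.2 this, Real.sq_sqrt this.le⟩
  have gap : ∀ s : ℝ, s ^ 2 = -M.det → areaForm R (M *ᵥ w + s • w) < 0 →
      ∃ v, areaForm P v < 0 ∧ areaForm Q v < 0 ∧ areaForm R v < 0 := by
    intro s hs hR
    set u := M *ᵥ w + s • w with hu
    have hu0 : u ≠ 0 := by
      rintro h0
      simp [h0, areaForm_eq] at hR
    have h1 := areaForm_neg_of_det_pos (by simp [hPt, hQt]) hPQ hPQn hu0
    have h2 : areaForm M u = 0 := by
      rw [det_fin_two, hm] at hs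
      simp only [areaForm_eq, hu, mulVec, dotProduct, Fin.sum_univ_two, hm, Pi.add_apply,
        Pi.smul_apply, smul_eq_mul]
      grind
    rw [areaForm_add] at h1
    rw [hM, sub_eq_add_neg, areaForm_add, areaForm_neg] at h2
    exact ⟨u, by linarith, by linarith, hR⟩
  have hMw : areaForm Q (M *ᵥ w) = μ ^ 2 * areaForm P w := by
    have : Q * M = -(M * P) := by rw [hM, mul_sub, sub_mul, hP, hQ]; abel
    rw [hμM, areaForm, mulVec_mulVec, this, areaForm]
    simp only [neg_mulVec, ← mulVec_mulVec, det_fin_two, Pi.neg_apply]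
    generalize P *ᵥ w = z
    simp only [mulVec, dotProduct, Fin.sum_univ_two]
    ring
  have hRw : areaForm R w < 0 := by linarith [hPR w, areaForm_add P R w]
  have hRMw : areaForm R (M *ᵥ w) < 0 := by
    have : 0 < areaForm Q (M *ᵥ w) := by rw [hMw]; positivity
    linarith [hQR (M *ᵥ w), areaForm_add Q R (M *ᵥ w)]
  have par : areaForm R (M *ᵥ w + μ • w) + areaForm R (M *ᵥ w + (-μ) • w) =
      2 * areaForm R (M *ᵥ w) + 2 * μ ^ 2 * areaForm R w := by
    generalize M *ᵥ w = z
    simp only [areaForm_eq, Pi.add_apply, Pi.smul_apply, smul_eq_mul]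
    ring
  have hneg : 2 * μ ^ 2 * areaForm R w < 0 := mul_neg_of_pos_of_neg (by positivity) hRw
  rcases lt_or_ge (areaForm R (M *ᵥ w + μ • w)) 0 with h | h
  · exact gap μ hμM h
  · exact gap (-μ) (by rwa [neg_sq]) (by linarith)

lemma det_add_fin_two (M K : Matrix (Fin 2) (Fin 2) ℝ) :
    (M + K).det = M.det + K.det + M.trace * K.trace - (M * K).trace := by
  simp only [det_fin_two, trace_fin_two, mul_apply, Fin.sum_univ_two, Matrix.add_apply]
  ring

lemma det_mul_sub_mul (a b : Matrix (Fin 2) (Fin 2) ℝ) :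
    (a * b - b * a).det = 4 * a.det * b.det - a.trace ^ 2 * b.det - b.trace ^ 2 * a.det
      - (a * b.adjugate).trace ^ 2 + a.trace * b.trace * (a * b.adjugate).trace := by
  simp only [det_fin_two, trace_fin_two, mul_apply, Fin.sum_univ_two, Matrix.sub_apply,
    adjugate_fin_two, of_apply, cons_val', cons_val_zero, cons_val_one, cons_val_fin_one]
  ring

/-- The reflection in the common perpendicular of the axes of `a` and `b`. -/
lemma exists_reflection {a b : Matrix (Fin 2) (Fin 2) ℝ} (h : (a * b - b * a).det < 0) :
    ∃ P : Matrix (Fin 2) (Fin 2) ℝ,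
      P.trace = 0 ∧ P.det = -1 ∧ (a * P).trace = 0 ∧ (b * P).trace = 0 := by
  have hδ : √(-(a * b - b * a).det) ^ 2 = -(a * b - b * a).det := Real.sq_sqrt (by linarith)
  refine ⟨(√(-(a * b - b * a).det))⁻¹ • (a * b - b * a), ?_, ?_, ?_, ?_⟩
  · rw [trace_smul, trace_sub, trace_mul_comm, sub_self, smul_zero]
  · rw [det_smul, Fintype.card_fin, inv_pow, hδ, inv_neg, neg_mul, inv_mul_cancel₀ h.ne]
  · rw [Matrix.mul_smul, trace_smul, mul_sub, trace_sub, ← mul_assoc, ← mul_assoc,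
      trace_mul_comm (a * b), ← mul_assoc, sub_self, smul_zero]
  · rw [Matrix.mul_smul, trace_smul, mul_sub, trace_sub, ← mul_assoc, ← mul_assoc,
      trace_mul_comm (b * a), ← mul_assoc, sub_self, smul_zero]

/-- A reflection `P` such that the arcs cut out by `P`, `-a P` and `-b P` are disjoint and leave a
gap on the projective line. -/
lemma exists_disjoint_reflections {a b : Matrix (Fin 2) (Fin 2) ℝ} (ha : a.det = 1)
    (hb : b.det = 1) (hat : 2 < a.trace) (hbt : 2 < b.trace)
    (hab : (a * b.adjugate).trace ≤ -2) :
    ∃ P : Matrix (Fin 2) (Fin 2) ℝ,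
      P * P = 1 ∧ -(a * P) * -(a * P) = 1 ∧ -(b * P) * -(b * P) = 1 ∧
      (∀ v, areaForm (P + -(a * P)) v ≤ 0) ∧ (∀ v, areaForm (P + -(b * P)) v ≤ 0) ∧
      (∀ v, areaForm (-(a * P) + -(b * P)) v ≤ 0) ∧
      ∃ v, areaForm P v < 0 ∧ areaForm (-(a * P)) v < 0 ∧ areaForm (-(b * P)) v < 0 := by
  have hN : (a * b - b * a).det < 0 := by
    rw [det_mul_sub_mul, ha, hb]
    have : 4 < a.trace * b.trace := by nlinarith
    nlinarith
  obtain ⟨P₀, ht₀, hd₀, hat₀, hbt₀⟩ := exists_reflection hN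
  have hdet : ∀ {c P : Matrix (Fin 2) (Fin 2) ℝ}, c.det = 1 → P.det = -1 →
      (-(c * P)).det = -1 := by
    intro c P hc hP
    simp [det_neg, hc, hP]
  have hpair : ∀ {c P : Matrix (Fin 2) (Fin 2) ℝ}, P * P = 1 →
      (P * -(c * P)).trace = -c.trace := by
    intro c P hP
    rw [mul_neg, trace_neg, trace_mul_comm, mul_assoc, hP, mul_one]
  have hsum : ∀ {c P : Matrix (Fin 2) (Fin 2) ℝ}, c.det = 1 → 2 < c.trace → P.trace = 0 →
      P.det = -1 → 0 < (P + -(c * P)).det := by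
    intro c P hc hct ht hd
    rw [det_add_fin_two, hpair (mul_self_eq_one_of_trace_det ht hd), hdet hc hd, ht, hd]
    linarith
  obtain ⟨P, ht, hd, haP, hbP, hneg⟩ : ∃ P : Matrix (Fin 2) (Fin 2) ℝ, P.trace = 0 ∧
      P.det = -1 ∧ (-(a * P)).trace = 0 ∧ (-(b * P)).trace = 0 ∧
      ∀ v, areaForm (P + -(a * P)) v ≤ 0 := by
    rcases areaForm_nonpos_or_neg (M := P₀ + -(a * P₀)) (by simp [ht₀, hat₀])
      (hsum ha hat ht₀ hd₀).le with h | h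
    · exact ⟨P₀, ht₀, hd₀, by simp [hat₀], by simp [hbt₀], h⟩
    · refine ⟨-P₀, by simp [ht₀], by simp [det_neg, hd₀], by simp [hat₀], by simp [hbt₀], ?_⟩
      simpa only [neg_add, mul_neg] using h
  have hP := mul_self_eq_one_of_trace_det ht hd
  have hQ := mul_self_eq_one_of_trace_det haP (hdet ha hd)
  have hR := mul_self_eq_one_of_trace_det hbP (hdet hb hd)
  have hQR : (-(a * P) * -(b * P)).trace = (a * b.adjugate).trace := by
    have : P * (b * P) = b.adjugate := by
      calc P * (b * P) = b.adjugate * b * (P * (b * P)) := by rw [adjugate_mul, hb]; simp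
        _ = b.adjugate * (-(b * P) * -(b * P)) := by simp only [neg_mul_neg, mul_assoc]
        _ = b.adjugate := by rw [hR, mul_one]
    rw [neg_mul_neg, mul_assoc, this]
  have hPQt : (P + -(a * P)).trace = 0 := by rw [trace_add, ht, haP, add_zero]
  have hPRt : (P + -(b * P)).trace = 0 := by rw [trace_add, ht, hbP, add_zero]
  have hQRt : (-(a * P) + -(b * P)).trace = 0 := by rw [trace_add, haP, hbP, add_zero]
  have hQRd : 0 ≤ (-(a * P) + -(b * P)).det := by
    rw [det_add_fin_two, hdet ha hd, hdet hb hd, haP, hQR]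
    linarith
  have hone : (1 : Matrix (Fin 2) (Fin 2) ℝ).trace = 2 := by simp
  have hPR : ∀ v, areaForm (P + -(b * P)) v ≤ 0 := by
    refine areaForm_nonpos_of_trace_mul_neg hPQt (hsum ha hat ht hd).le hPRt
      (hsum hb hbt ht hd).le ?_ hneg
    rw [add_mul, mul_add, mul_add, hP, trace_add, trace_add, trace_add, hpair hP,
      trace_mul_comm (-(a * P)) P, hpair hP, hQR, hone]
    linarith
  have hQRn : ∀ v, areaForm (-(a * P) + -(b * P)) v ≤ 0 := by
    refine areaForm_nonpos_of_trace_mul_neg hPQt (hsum ha hat ht hd).le hQRt hQRd ?_ hneg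
    rw [add_mul, mul_add, mul_add, hQ, trace_add, trace_add, trace_add, hpair hP, hpair hP, hQR,
      hone]
    linarith
  exact ⟨P, hP, hQ, hR, hneg, hPR, hQRn,
    exists_areaForm_neg ht haP hP hQ (hsum ha hat ht hd) hneg hPR hQRn⟩

/-- A ping-pong lemma: if each letter times an element played by a letter other than its inverse is
played by the first letter, then every nontrivial word is played by some letter. -/
lemma FreeGroup.exists_lift_mem_of_ping_pong {ι G : Type*} [Group G] (c : ι → G)
    (S : ι × Bool → Set G) (hS : ∀ l, cond l.2 (c l.1) (c l.1)⁻¹ ∈ S l)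
    (hmul : ∀ l m, (l.1 = m.1 → l.2 = m.2) → ∀ g ∈ S m, cond l.2 (c l.1) (c l.1)⁻¹ * g ∈ S l)
    {w : FreeGroup ι} (hw : w ≠ 1) : ∃ l, FreeGroup.lift c w ∈ S l := by
  classical
  have key : ∀ L : List (ι × Bool), ∀ l, FreeGroup.IsReduced (l :: L) →
      ((l :: L).map fun x => cond x.2 (c x.1) (c x.1)⁻¹).prod ∈ S l := by
    intro L
    induction L with
    | nil => intro l _; simpa using hS l
    | cons m L ih =>
      intro l h
      obtain ⟨hlm, h⟩ := FreeGroup.isReduced_cons_cons.1 h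
      rw [List.map_cons, List.prod_cons]
      exact hmul l m hlm _ (ih m h)
  rw [← FreeGroup.mk_toWord (x := w), FreeGroup.lift_mk]
  have hr := FreeGroup.isReduced_toWord (x := w)
  rcases hL : w.toWord with _ | ⟨l, L⟩
  · exact absurd (FreeGroup.toWord_eq_nil_iff.1 hL) hw
  · exact ⟨l, key L l (hL ▸ hr)⟩

/-- If the reflections `P` and `Q i` cut out disjoint arcs, then nontrivial words in the products
`-(Q i * P)` move every point of the gap out of the gap. -/
lemma areaForm_lift_pos {ι : Type*} {c : ι → Matrix.SpecialLinearGroup (Fin 2) ℝ}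
    {P : Matrix (Fin 2) (Fin 2) ℝ} {Q : ι → Matrix (Fin 2) (Fin 2) ℝ} (hP : P * P = 1)
    (hQ : ∀ i, Q i * Q i = 1) (hc : ∀ i, (c i : Matrix (Fin 2) (Fin 2) ℝ) = -(Q i * P))
    (hPQ : ∀ i v, areaForm (P + Q i) v ≤ 0)
    (hQQ : ∀ i j, i ≠ j → ∀ v, areaForm (Q i + Q j) v ≤ 0) {v : Fin 2 → ℝ}
    (hPv : areaForm P v < 0) (hQv : ∀ i, areaForm (Q i) v < 0) {w : FreeGroup ι} (hw : w ≠ 1) :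
    0 < areaForm P ((FreeGroup.lift c w : Matrix (Fin 2) (Fin 2) ℝ) *ᵥ v) ∨
      ∃ i, 0 < areaForm (Q i) ((FreeGroup.lift c w : Matrix (Fin 2) (Fin 2) ℝ) *ᵥ v) := by
  simp only [areaForm_add] at hPQ hQQ
  have hci : ∀ i, ((c i)⁻¹ : Matrix.SpecialLinearGroup (Fin 2) ℝ) =
      (-(P * Q i) : Matrix (Fin 2) (Fin 2) ℝ) := by
    intro i
    have h : (c i : Matrix (Fin 2) (Fin 2) ℝ) * -(P * Q i) = 1 := by
      rw [hc, neg_mul_neg, mul_assoc, ← mul_assoc P, hP, one_mul, hQ]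
    calc (((c i)⁻¹ : Matrix.SpecialLinearGroup (Fin 2) ℝ) : Matrix (Fin 2) (Fin 2) ℝ)
        = ((c i)⁻¹ : Matrix.SpecialLinearGroup (Fin 2) ℝ) * (c i * -(P * Q i)) := by
          rw [h, mul_one]
      _ = -(P * Q i) := by
          rw [← mul_assoc, ← Matrix.SpecialLinearGroup.coe_mul, inv_mul_cancel,
            Matrix.SpecialLinearGroup.coe_one, one_mul]
  have hfwd : ∀ i u, areaForm (Q i) ((c i : Matrix (Fin 2) (Fin 2) ℝ) *ᵥ u) =
      -areaForm (Q i) (P *ᵥ u) := by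
    intro i u
    rw [hc, neg_mulVec, areaForm_neg_right, ← mulVec_mulVec, areaForm_mulVec_self (hQ i)]
  have hbwd : ∀ i u, areaForm (Q i) (P *ᵥ (((c i)⁻¹ : Matrix.SpecialLinearGroup (Fin 2) ℝ) :
      Matrix (Fin 2) (Fin 2) ℝ) *ᵥ u) = -areaForm (Q i) u := by
    intro i u
    rw [hci, mulVec_mulVec, mul_neg, ← mul_assoc, hP, one_mul, neg_mulVec, areaForm_neg_right,
      areaForm_mulVec_self (hQ i)]
  have hPP := areaForm_mulVec_self hP
  let S : ι × Bool → Set (Matrix.SpecialLinearGroup (Fin 2) ℝ) := fun l =>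
    {g | 0 < areaForm (Q l.1) (cond l.2 ((g : Matrix (Fin 2) (Fin 2) ℝ) *ᵥ v)
      (P *ᵥ (g : Matrix (Fin 2) (Fin 2) ℝ) *ᵥ v))}
  have hS : ∀ l, cond l.2 (c l.1) (c l.1)⁻¹ ∈ S l := by
    rintro ⟨i, _ | _⟩ <;> simp only [S, Set.mem_ofPred_eq, cond_false, cond_true]
    · rw [hbwd]
      linarith [hQv i]
    · rw [hfwd]
      linarith [hPQ i (P *ᵥ v), hPP v]
  have hmul : ∀ l m, (l.1 = m.1 → l.2 = m.2) → ∀ g ∈ S m,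
      cond l.2 (c l.1) (c l.1)⁻¹ * g ∈ S l := by
    rintro ⟨i, s⟩ ⟨j, t⟩ hlm g hg
    simp only [S, Set.mem_ofPred_eq] at hg ⊢
    generalize hu : (g : Matrix (Fin 2) (Fin 2) ℝ) *ᵥ v = u at hg
    have hPu := hPP u
    cases s <;>
      simp only [cond_false, cond_true, Matrix.SpecialLinearGroup.coe_mul, ← mulVec_mulVec, hu,
        hbwd, hfwd] <;>
      cases t <;> simp only [cond_false, cond_true] at hg
    · linarith [hPQ j (P *ᵥ u), hPQ i u]
    · linarith [hQQ i j (fun h => by simpa using hlm h) u]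
    · linarith [hQQ i j (fun h => by simpa using hlm h) (P *ᵥ u)]
    · linarith [hPQ j u, hPQ i (P *ᵥ u)]
  obtain ⟨⟨i, _ | _⟩, hl⟩ := FreeGroup.exists_lift_mem_of_ping_pong c S hS hmul hw
  · simp only [S, Set.mem_ofPred_eq, cond_false] at hl
    left
    linarith [hPP ((FreeGroup.lift c w : Matrix (Fin 2) (Fin 2) ℝ) *ᵥ v),
      hPQ i (P *ᵥ (FreeGroup.lift c w : Matrix (Fin 2) (Fin 2) ℝ) *ᵥ v)]
  · exact Or.inr ⟨i, hl⟩

lemma continuous_areaForm_mulVec (Q : Matrix (Fin 2) (Fin 2) ℝ) (v : Fin 2 → ℝ) :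
    Continuous fun M : Matrix (Fin 2) (Fin 2) ℝ => areaForm Q (M *ᵥ v) := by
  unfold areaForm
  fun_prop

/-- Gilman–Maskit, step (1): if `tr A ≥ tr B > 2` and `tr (A B⁻¹) ≤ -2`, then
`⟨A, B⟩` is discrete and free of rank 2 on the generators `A` and `B`. -/
theorem gilman_maskit_discrete_free
    (A B : Matrix.SpecialLinearGroup (Fin 2) ℝ)
    (hAB : Matrix.trace (A : Matrix (Fin 2) (Fin 2) ℝ) ≥
      Matrix.trace (B : Matrix (Fin 2) (Fin 2) ℝ))
    (hB : Matrix.trace (B : Matrix (Fin 2) (Fin 2) ℝ) > 2)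
    (htr : Matrix.trace ((A * B⁻¹ : Matrix.SpecialLinearGroup (Fin 2) ℝ) :
      Matrix (Fin 2) (Fin 2) ℝ) ≤ -2) :
    DiscreteTopology (Subgroup.closure {A, B}) ∧
      Function.Injective
        (FreeGroup.lift (![A, B]) : FreeGroup (Fin 2) →* Matrix.SpecialLinearGroup (Fin 2) ℝ) := by
  rw [Matrix.SpecialLinearGroup.coe_mul, Matrix.SpecialLinearGroup.coe_inv] at htr
  obtain ⟨P, hP, hQ, hR, hPQ, hPR, hQR, v, hPv, hQv, hRv⟩ :=
    exists_disjoint_reflections A.det_coe B.det_coe (by linarith) hB htr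
  have hgap {w : FreeGroup (Fin 2)} (hw : w ≠ 1) := areaForm_lift_pos (c := ![A, B])
    (Q := ![-((A : Matrix (Fin 2) (Fin 2) ℝ) * P), -((B : Matrix (Fin 2) (Fin 2) ℝ) * P)]) hP
    (by rw [Fin.forall_fin_two]; exact ⟨hQ, hR⟩)
    (by simp [Fin.forall_fin_two, mul_assoc, hP])
    (by rw [Fin.forall_fin_two]; exact ⟨hPQ, hPR⟩)
    (by
      simp only [Fin.forall_fin_two]
      exact ⟨⟨fun h => absurd rfl h, fun _ => hQR⟩,
        ⟨fun _ => by rw [add_comm]; exact hQR, fun h => absurd rfl h⟩⟩)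
    hPv (by rw [Fin.forall_fin_two]; exact ⟨hQv, hRv⟩) hw
  simp only [Fin.exists_fin_two, cons_val_zero, cons_val_one] at hgap
  set Γ := Subgroup.closure {A, B} with hΓ
  let U : Set (Matrix (Fin 2) (Fin 2) ℝ) := {M | areaForm P (M *ᵥ v) < 0 ∧
    areaForm (-((A : Matrix (Fin 2) (Fin 2) ℝ) * P)) (M *ᵥ v) < 0 ∧
    areaForm (-((B : Matrix (Fin 2) (Fin 2) ℝ) * P)) (M *ᵥ v) < 0}
  have hU : IsOpen U :=
    ((isOpen_lt (continuous_areaForm_mulVec _ v) continuous_const).inter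
      ((isOpen_lt (continuous_areaForm_mulVec _ v) continuous_const).inter
        (isOpen_lt (continuous_areaForm_mulVec _ v) continuous_const)))
  have h1U : (1 : Matrix (Fin 2) (Fin 2) ℝ) ∈ U := by
    simpa only [U, Set.mem_ofPred_eq, one_mulVec] using ⟨hPv, hQv, hRv⟩
  have hw1 {w : FreeGroup (Fin 2)}
      (hw : (FreeGroup.lift ![A, B] w : Matrix (Fin 2) (Fin 2) ℝ) ∈ U) : w = 1 := by
    by_contra hne
    obtain ⟨h0, h1, h2⟩ := hw
    rcases hgap hne with h | h | h <;> linarith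
  refine ⟨?_, (injective_iff_map_eq_one _).2 fun w hw => hw1 (by
    rw [hw, Matrix.SpecialLinearGroup.coe_one]; exact h1U)⟩
  have hU1 {g : Matrix.SpecialLinearGroup (Fin 2) ℝ} (hg : g ∈ Γ)
      (hgU : (g : Matrix (Fin 2) (Fin 2) ℝ) ∈ U) : g = 1 := by
    have hrange : Γ = (FreeGroup.lift ![A, B]).range := by
      rw [FreeGroup.range_lift_eq_closure, hΓ]
      simp [Set.pair_comm]
    rw [hrange] at hg
    obtain ⟨w, rfl⟩ := hg
    rw [hw1 hgU, map_one]
  have hcoe : Continuous fun g : Γ =>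
      ((g : Matrix.SpecialLinearGroup (Fin 2) ℝ) : Matrix (Fin 2) (Fin 2) ℝ) :=
    continuous_induced_dom.comp continuous_subtype_val
  refine discreteTopology_iff_isOpen_singleton.2 fun h => ?_
  have hmul : Continuous fun g : Γ =>
      (((h⁻¹ * g : Γ) : Matrix.SpecialLinearGroup (Fin 2) ℝ) : Matrix (Fin 2) (Fin 2) ℝ) :=
    continuous_const.matrix_mul hcoe
  convert hU.preimage hmul using 1
  ext g
  rw [Set.mem_singleton_iff, Set.mem_preimage]
  constructor
  · rintro rfl
    rw [inv_mul_cancel, Subgroup.coe_one, Matrix.SpecialLinearGroup.coe_one]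
    exact h1U
  · intro hg
    exact (inv_mul_eq_one.1 (Subtype.ext (hU1 (h⁻¹ * g).2 hg))).symm
end

section
/- Let A, B ∈ SL(2,ℝ) satisfy tr(A) ≥ tr(B) > 2 and −2 < tr(A·B⁻¹) < 2. Then the subgroup G = ⟨A, B⟩ of SL(2,ℝ) generated by A and B is either not discrete or not a free group; equivalently, it is not the case that G is discrete and G is isomorphic to a free group. More precisely, if G is discrete then G contains a nontrivial element of finite order. -/
/-- If `J² = -1`, powers of `cos θ + sin θ J` follow de Moivre's formula. -/
theorem cos_add_sin_smul_pow {R : Type*} [Ring R] [Algebra ℝ R] {J : R} (hJ : J * J = -1)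
    (θ : ℝ) (n : ℕ) :
    (Real.cos θ • (1 : R) + Real.sin θ • J) ^ n =
      Real.cos (n * θ) • (1 : R) + Real.sin (n * θ) • J := by
  induction n with
  | zero => simp
  | succ n ih =>
    have h : ((n + 1 : ℕ) : ℝ) * θ = n * θ + θ := by push_cast; ring
    rw [pow_succ, ih, h, Real.cos_add, Real.sin_add]
    simp only [add_mul, mul_add, smul_mul_smul_comm, mul_one, one_mul, hJ]
    module

/-- Multiples of a real number come arbitrarily close to multiples of `2π`. -/
theorem exists_nat_abs_mul_sub_two_pi_lt (θ : ℝ) {ε : ℝ} (hε : 0 < ε) :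
    ∃ n : ℕ, 0 < n ∧ ∃ m : ℤ, |n * θ - m * (2 * Real.pi)| < ε := by
  have hpi : 0 < 2 * Real.pi := Real.two_pi_pos
  obtain ⟨N, hN⟩ := exists_nat_one_div_lt (div_pos hε hpi)
  obtain ⟨n, hn, -, h⟩ :=
    Real.exists_nat_abs_mul_sub_round_le (θ / (2 * Real.pi)) N.succ_pos
  refine ⟨n, hn, round (n * (θ / (2 * Real.pi))), ?_⟩
  set m := round (n * (θ / (2 * Real.pi)))
  have h₁ : 1 / (((N.succ : ℕ) : ℝ) + 1) ≤ 1 / ((N : ℝ) + 1) := by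
    push_cast
    gcongr
    linarith
  have h₂ := (h.trans h₁).trans_lt hN
  rw [lt_div_iff₀ hpi] at h₂
  calc |n * θ - m * (2 * Real.pi)|
      = |(n * (θ / (2 * Real.pi)) - m) * (2 * Real.pi)| := by
        congr 1
        field_simp
    _ = |n * (θ / (2 * Real.pi)) - m| * (2 * Real.pi) := by rw [abs_mul, abs_of_pos hpi]
    _ < ε := h₂

/-- A `2 × 2` real matrix of determinant one and trace in `(-2, 2)` is a rotation for a suitable
complex structure. -/
theorem exists_eq_cos_add_sin_smul {M : Matrix (Fin 2) (Fin 2) ℝ} (hdet : M.det = 1)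
    (h₁ : -2 < M.trace) (h₂ : M.trace < 2) :
    ∃ (θ : ℝ) (J : Matrix (Fin 2) (Fin 2) ℝ), J * J = -1 ∧
      M = Real.cos θ • (1 : Matrix (Fin 2) (Fin 2) ℝ) + Real.sin θ • J := by
  set θ := Real.arccos (M.trace / 2) with hθ
  have hcos : Real.cos θ = M.trace / 2 := Real.cos_arccos (by linarith) (by linarith)
  have hsq := Real.sin_sq_add_cos_sq θ
  have hsin : Real.sin θ ≠ 0 := by
    intro h
    rw [h, hcos] at hsq
    nlinarith
  refine ⟨θ, (Real.sin θ)⁻¹ • (M - Real.cos θ • 1), ?_, ?_⟩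
  · rw [smul_mul_smul_comm]
    have key : (M - Real.cos θ • 1) * (M - Real.cos θ • 1) =
        (-(Real.sin θ * Real.sin θ)) • (1 : Matrix (Fin 2) (Fin 2) ℝ) := by
      have hs : Real.sin θ * Real.sin θ = 1 - (M.trace / 2) ^ 2 := by rw [← hcos]; linarith
      rw [hs, hcos]
      rw [Matrix.det_fin_two] at hdet
      rw [Matrix.trace_fin_two]
      ext i j
      fin_cases i <;> fin_cases j <;> simp [Matrix.mul_apply, Fin.sum_univ_two] <;> linarith
    rw [key, smul_smul]
    have : (Real.sin θ)⁻¹ * (Real.sin θ)⁻¹ * -(Real.sin θ * Real.sin θ) = -1 := by field_simp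
    rw [this, neg_one_smul]
  · rw [smul_inv_smul₀ hsin]
    abel

/-- An elliptic element of a discrete subgroup of `SL(2, ℝ)` has finite order. -/
theorem isOfFinOrder_of_elliptic (G : Subgroup (Matrix.SpecialLinearGroup (Fin 2) ℝ))
    [DiscreteTopology G] (x : G)
    (h₁ : -2 < Matrix.trace
      ((x : Matrix.SpecialLinearGroup (Fin 2) ℝ) : Matrix (Fin 2) (Fin 2) ℝ))
    (h₂ : Matrix.trace
      ((x : Matrix.SpecialLinearGroup (Fin 2) ℝ) : Matrix (Fin 2) (Fin 2) ℝ) < 2) :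
    IsOfFinOrder x := by
  obtain ⟨θ, J, hJ, hx⟩ := exists_eq_cos_add_sin_smul x.1.2 h₁ h₂
  obtain ⟨U, hU, hU₁⟩ := isOpen_induced_iff.mp (isOpen_discrete ({1} : Set G))
  obtain ⟨V, hV, rfl⟩ := isOpen_induced_iff.mp hU
  let F : ℝ → Matrix (Fin 2) (Fin 2) ℝ := fun φ => Real.cos φ • 1 + Real.sin φ • J
  have hF : Continuous F := by fun_prop
  have h_one : F 0 ∈ V := by
    have h : (1 : G) ∈ ({1} : Set G) := rfl
    rw [← hU₁] at h
    have hF₀ : F 0 = 1 := by simp [F]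
    rw [hF₀]
    exact h
  obtain ⟨ε, hε, hball⟩ := Metric.isOpen_iff.mp (hV.preimage hF) 0 h_one
  obtain ⟨n, hn, m, hm⟩ := exists_nat_abs_mul_sub_two_pi_lt θ hε
  have hmem : F (n * θ - m * (2 * Real.pi)) ∈ V := hball (by simpa [Real.dist_eq] using hm)
  have hpow : x ^ n ∈ ({1} : Set G) := by
    rw [← hU₁]
    change (((x ^ n : G) : Matrix.SpecialLinearGroup (Fin 2) ℝ) : Matrix (Fin 2) (Fin 2) ℝ) ∈ V
    rw [Subgroup.coe_pow, Matrix.SpecialLinearGroup.coe_pow, hx, cos_add_sin_smul_pow hJ]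
    simpa only [F, Real.cos_sub_int_mul_two_pi, Real.sin_sub_int_mul_two_pi] using hmem
  exact isOfFinOrder_iff_pow_eq_one.mpr ⟨n, hn, hpow⟩

/-- Gilman–Maskit, step (4): if `tr A ≥ tr B > 2` and `-2 < tr (A B⁻¹) < 2`, then
`G = ⟨A, B⟩` is not both discrete and isomorphic to a free group; more precisely,
if `G` is discrete then it contains a nontrivial element of finite order. -/
theorem gilman_maskit_elliptic_case
    (A B : Matrix.SpecialLinearGroup (Fin 2) ℝ)
    (hAB : Matrix.trace (A : Matrix (Fin 2) (Fin 2) ℝ) ≥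
      Matrix.trace (B : Matrix (Fin 2) (Fin 2) ℝ))
    (hB : Matrix.trace (B : Matrix (Fin 2) (Fin 2) ℝ) > 2)
    (htr1 : -2 < Matrix.trace ((A * B⁻¹ : Matrix.SpecialLinearGroup (Fin 2) ℝ) :
      Matrix (Fin 2) (Fin 2) ℝ))
    (htr2 : Matrix.trace ((A * B⁻¹ : Matrix.SpecialLinearGroup (Fin 2) ℝ) :
      Matrix (Fin 2) (Fin 2) ℝ) < 2) :
    (¬ (DiscreteTopology (Subgroup.closure {A, B}) ∧
        ∃ α : Type, Nonempty ((Subgroup.closure {A, B}) ≃* FreeGroup α))) ∧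
      (DiscreteTopology (Subgroup.closure {A, B}) →
        ∃ x : Subgroup.closure {A, B}, x ≠ 1 ∧ IsOfFinOrder x) := by
  have torsion : DiscreteTopology (Subgroup.closure {A, B}) →
      ∃ x : Subgroup.closure {A, B}, x ≠ 1 ∧ IsOfFinOrder x := by
    intro _
    have hA : A ∈ Subgroup.closure {A, B} := Subgroup.subset_closure (by simp)
    have hB' : B ∈ Subgroup.closure {A, B} := Subgroup.subset_closure (by simp)
    refine ⟨⟨A * B⁻¹, mul_mem hA (inv_mem hB')⟩, ?_, isOfFinOrder_of_elliptic _ _ htr1 htr2⟩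
    intro h
    rw [show A * B⁻¹ = 1 from congrArg Subtype.val h] at htr2
    simp at htr2
  refine ⟨?_, torsion⟩
  rintro ⟨hdisc, α, ⟨e⟩⟩
  obtain ⟨x, hx, hfin⟩ := torsion hdisc
  have h := (e.toMonoidHom.isOfFinOrder hfin).eq_one'
  exact hx ((map_eq_one_iff e e.injective).mp h)
end
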